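/- Let q be a real number with 0 < q < 1. Then the fifth cumulant of the random variable γ_n^*(1) satisfies lim_{n→∞} ( e_{n,5}(q) - 5 e_{n,1}(q) e_{n,4}(q) - 10 e_{n,2}(q) e_{n,3}(q) + 20 e_{n,1}(q)^2 e_{n,3}(q) + 30 e_{n,1}(q) e_{n,2}(q)^2 - 60 e_{n,1}(q)^3 e_{n,2}(q) + 24 e_{n,1}(q)^5 ) = - ∑_{m=1}^∞ σ_4(m) q^m. -/

import Mathlib

/-- The `k`-th moment `e_{n,k}(q) = ∑_{h=1}^n h^k q^{n-h} ∏_{j=1}^{h-1} (1 - q^{n-j})`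
of the Simon–Crippa–Collenberg random variable `γ_n^*(1)`. -/
noncomputable def momentE (q : ℝ) (n k : ℕ) : ℝ :=
  ∑ h ∈ Finset.Icc 1 n, (h : ℝ) ^ k * q ^ (n - h) * ∏ j ∈ Finset.Icc 1 (h - 1), (1 - q ^ (n - j))

open Filter Topology Finset

namespace FifthCumulant

/-- The finite product `(q;q)_m`. -/
noncomputable def Q (q : ℝ) (m : ℕ) : ℝ := ∏ i ∈ range m, (1 - q ^ (i + 1))

/-- Unnormalised limiting weights `q^m / (q;q)_m`. -/
noncomputable def a (q : ℝ) (m : ℕ) : ℝ := q ^ m / Q q m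

/-- Power sums `q^d / (1 - q^d)` (zero for `d = 0`). -/
noncomputable def p (q : ℝ) (d : ℕ) : ℝ := q ^ d / (1 - q ^ d)

variable {q : ℝ}

lemma one_sub_pos (hq0 : 0 < q) (hq1 : q < 1) (m : ℕ) : 0 < 1 - q ^ (m + 1) := by
  have := pow_lt_one₀ hq0.le hq1 (Nat.succ_ne_zero m)
  simpa using this

lemma Q_pos (hq0 : 0 < q) (hq1 : q < 1) (m : ℕ) : 0 < Q q m :=
  prod_pos fun i _ => one_sub_pos hq0 hq1 i

lemma Q_succ (m : ℕ) : Q q (m + 1) = Q q m * (1 - q ^ (m + 1)) := by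
  simp [Q, prod_range_succ]

lemma a_pos (hq0 : 0 < q) (hq1 : q < 1) (m : ℕ) : 0 < a q m :=
  div_pos (pow_pos hq0 m) (Q_pos hq0 hq1 m)

lemma a_succ (hq0 : 0 < q) (hq1 : q < 1) (m : ℕ) :
    (1 - q ^ (m + 1)) * a q (m + 1) = q * a q m := by
  have h1 := (one_sub_pos hq0 hq1 m).ne'
  have h2 := (Q_pos hq0 hq1 m).ne'
  rw [a, a, Q_succ]
  field_simp
  ring

lemma p_zero : p q 0 = 0 := by simp [p]

lemma p_succ (hq0 : 0 < q) (hq1 : q < 1) (d : ℕ) :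
    (1 - q ^ (d + 1)) * p q (d + 1) = q ^ (d + 1) := by
  have h1 := (one_sub_pos hq0 hq1 d).ne'
  rw [p]
  field_simp

lemma newton (hq0 : 0 < q) (hq1 : q < 1) (m : ℕ) :
    ∑ x ∈ antidiagonal m, p q x.1 * a q x.2 = m * a q m := by
  induction m with
  | zero => simp [p_zero]
  | succ m ih =>
    have h1 := (one_sub_pos hq0 hq1 m).ne'
    apply mul_left_cancel₀ h1
    have e1 : (1 - q ^ (m + 1)) * ∑ x ∈ antidiagonal (m + 1), p q x.1 * a q x.2
        = ∑ x ∈ antidiagonal (m + 1), (1 - q ^ x.1) * p q x.1 * a q x.2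
          + ∑ x ∈ antidiagonal (m + 1), p q x.1 * q ^ x.1 * ((1 - q ^ x.2) * a q x.2) := by
      rw [mul_sum, ← sum_add_distrib]
      refine sum_congr rfl fun x hx => ?_
      rw [← mem_antidiagonal.mp hx, pow_add]
      ring
    have e2 : ∑ x ∈ antidiagonal (m + 1), (1 - q ^ x.1) * p q x.1 * a q x.2
        = ∑ x ∈ antidiagonal m, q * q ^ x.1 * a q x.2 := by
      rw [Finset.Nat.sum_antidiagonal_succ]
      simp only [p_zero, p_succ hq0 hq1]
      simp [pow_succ']
    have e3 : ∑ x ∈ antidiagonal (m + 1), p q x.1 * q ^ x.1 * ((1 - q ^ x.2) * a q x.2)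
        = ∑ x ∈ antidiagonal m, p q x.1 * q ^ x.1 * (q * a q x.2) := by
      rw [Finset.Nat.sum_antidiagonal_succ']
      simp only [a_succ hq0 hq1]
      simp
    have e4 : ∀ d : ℕ, q ^ d + p q d * q ^ d = p q d + if d = 0 then 1 else 0 := by
      intro d
      cases d with
      | zero => simp [p_zero]
      | succ d =>
        have := p_succ hq0 hq1 d
        simp only [Nat.succ_ne_zero, if_false]
        linarith
    have e5 : ∑ x ∈ antidiagonal m, (if x.1 = 0 then (1 : ℝ) else 0) * a q x.2 = a q m := by
      rw [Finset.Nat.sum_antidiagonal_eq_sum_range_succ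
        (fun i j => (if i = 0 then (1 : ℝ) else 0) * a q j)]
      simp
    rw [e1, e2, e3, ← sum_add_distrib]
    have e6 : ∑ x ∈ antidiagonal m, (q * q ^ x.1 * a q x.2 + p q x.1 * q ^ x.1 * (q * a q x.2))
        = q * (∑ x ∈ antidiagonal m, p q x.1 * a q x.2
          + ∑ x ∈ antidiagonal m, (if x.1 = 0 then (1 : ℝ) else 0) * a q x.2) := by
      rw [← sum_add_distrib, mul_sum]
      refine sum_congr rfl fun x _ => ?_
      have := e4 x.1
      linear_combination q * a q x.2 * this
    rw [e6, e5, ih]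
    have := a_succ hq0 hq1 m
    push_cast
    linear_combination (-(m : ℝ) - 1) * this

lemma tendsto_pow_succ (hq0 : 0 < q) (hq1 : q < 1) :
    Tendsto (fun m : ℕ => q ^ (m + 1)) atTop (𝓝 0) :=
  (tendsto_pow_atTop_nhds_zero_of_lt_one hq0.le hq1).comp (tendsto_add_atTop_nat 1)

lemma tendsto_ratio (k : ℕ) :
    Tendsto (fun m : ℕ => (((m + 1 : ℕ) : ℝ) / m) ^ k) atTop (𝓝 1) := by
  have h : Tendsto (fun m : ℕ => ((m + 1 : ℕ) : ℝ) / m) atTop (𝓝 1) := by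
    have h0 : Tendsto (fun m : ℕ => 1 + 1 / (m : ℝ)) atTop (𝓝 (1 + 0)) :=
      tendsto_const_nhds.add tendsto_one_div_atTop_nhds_zero_nat
    rw [add_zero] at h0
    refine h0.congr' ?_
    filter_upwards [eventually_gt_atTop 0] with m hm
    have : (m : ℝ) ≠ 0 := by positivity
    push_cast
    field_simp
  simpa using h.pow k

lemma summable_a (hq0 : 0 < q) (hq1 : q < 1) (k : ℕ) :
    Summable fun m : ℕ => (m : ℝ) ^ k * a q m := by
  refine summable_of_ratio_test_tendsto_lt_one hq1 ?_ ?_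
  · filter_upwards [eventually_gt_atTop 0] with m hm
    have := a_pos hq0 hq1 m
    positivity
  · have h0 : Tendsto (fun m : ℕ => (((m + 1 : ℕ) : ℝ) / m) ^ k * (q / (1 - q ^ (m + 1)))) atTop
        (𝓝 (1 * (q / (1 - 0)))) :=
      (tendsto_ratio k).mul (tendsto_const_nhds.div
        (tendsto_const_nhds.sub (tendsto_pow_succ hq0 hq1)) (by norm_num))
    rw [sub_zero, div_one, one_mul] at h0
    refine h0.congr' ?_
    filter_upwards [eventually_gt_atTop 0] with m hm
    have h1 := a_pos hq0 hq1 m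
    have h2 := a_pos hq0 hq1 (m + 1)
    have h3 := one_sub_pos hq0 hq1 m
    have h4 := a_succ hq0 hq1 m
    have hm' : (0 : ℝ) < m := by positivity
    rw [Real.norm_of_nonneg (by positivity), Real.norm_of_nonneg (by positivity), div_pow]
    field_simp
    linear_combination -h4

lemma p_nonneg (hq0 : 0 < q) (hq1 : q < 1) (m : ℕ) : 0 ≤ p q m := by
  cases m with
  | zero => simp [p_zero]
  | succ m => exact div_nonneg (by positivity) (one_sub_pos hq0 hq1 m).le

lemma summable_p (hq0 : 0 < q) (hq1 : q < 1) (k : ℕ) :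
    Summable fun m : ℕ => (m : ℝ) ^ k * p q m := by
  have hg : Summable fun m : ℕ => (m : ℝ) ^ k * q ^ m :=
    summable_pow_mul_geometric_of_norm_lt_one k (by rwa [Real.norm_of_nonneg hq0.le])
  refine Summable.of_nonneg_of_le
    (fun m => mul_nonneg (by positivity) (p_nonneg hq0 hq1 m)) (fun m => ?_)
    (hg.mul_left (1 / (1 - q)))
  have hq : 0 < 1 - q := by linarith
  cases m with
  | zero =>
    rw [p_zero, mul_zero]
    positivity
  | succ m =>
    have h1 := one_sub_pos hq0 hq1 m
    have h2 : q ^ (m + 1) ≤ q := pow_le_of_le_one hq0.le hq1.le (Nat.succ_ne_zero m)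
    have : p q (m + 1) ≤ 1 / (1 - q) * q ^ (m + 1) := by
      rw [p, div_mul_eq_mul_div, one_mul]
      exact div_le_div_of_nonneg_left (by positivity) hq (by linarith)
    calc _ ≤ ((m + 1 : ℕ) : ℝ) ^ k * (1 / (1 - q) * q ^ (m + 1)) := by gcongr
      _ = _ := by ring

/-- Limits of the unnormalised moments. -/
noncomputable def A (q : ℝ) (k : ℕ) : ℝ := ∑' m : ℕ, (m : ℝ) ^ k * a q m

/-- The cumulants (shifted by one). -/
noncomputable def P (q : ℝ) (k : ℕ) : ℝ := ∑' m : ℕ, (m : ℝ) ^ k * p q m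

lemma recursion (hq0 : 0 < q) (hq1 : q < 1) (k : ℕ) :
    A q (k + 1) = ∑ j ∈ range (k + 1), P q j * A q (k - j) * (k.choose j : ℝ) := by
  have hp : ∀ j, Summable fun m : ℕ => ‖(m : ℝ) ^ j * p q m‖ := fun j =>
    (summable_p hq0 hq1 j).norm
  have ha : ∀ j, Summable fun m : ℕ => ‖(m : ℝ) ^ j * a q m‖ := fun j =>
    (summable_a hq0 hq1 j).norm
  have key : ∀ j, HasSum (fun m : ℕ => (∑ x ∈ antidiagonal m,
      ((x.1 : ℝ) ^ j * p q x.1) * ((x.2 : ℝ) ^ (k - j) * a q x.2)) * (k.choose j : ℝ))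
      (P q j * A q (k - j) * (k.choose j : ℝ)) := by
    intro j
    refine HasSum.mul_right _ ?_
    rw [P, A, tsum_mul_tsum_eq_tsum_sum_antidiagonal_of_summable_norm (hp j) (ha (k - j))]
    exact (summable_norm_sum_mul_antidiagonal_of_summable_norm (hp j) (ha (k - j))).of_norm.hasSum
  have hs := hasSum_sum (s := range (k + 1)) fun j _ => key j
  rw [← hs.tsum_eq, A]
  refine tsum_congr fun m => ?_
  rw [pow_succ, mul_assoc, ← newton hq0 hq1, mul_sum]
  simp_rw [sum_mul]
  rw [sum_comm]
  refine sum_congr rfl fun x hx => ?_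
  rw [← mem_antidiagonal.mp hx]
  push_cast
  rw [add_pow, sum_mul]
  refine sum_congr rfl fun j _ => ?_
  ring

lemma P_four (hq0 : 0 < q) (hq1 : q < 1) :
    P q 4 = ∑' m : ℕ, (∑ d ∈ (m + 1).divisors, (d : ℝ) ^ 4) * q ^ (m + 1) := by
  have h := tsum_pow_div_one_sub_eq_tsum_sigma (𝕜 := ℝ) (r := q)
    (by rwa [Real.norm_of_nonneg hq0.le]) 4
  rw [tsum_pnat_eq_tsum_succ (f := fun n : ℕ => (n : ℝ) ^ 4 * q ^ n / (1 - q ^ n)),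
    tsum_pnat_eq_tsum_succ (f := fun n : ℕ => (ArithmeticFunction.sigma 4 n : ℝ) * q ^ n)] at h
  rw [P, (summable_p hq0 hq1 4).tsum_eq_zero_add, p_zero, mul_zero, zero_add]
  simp only [ArithmeticFunction.sigma_apply, Nat.cast_sum, Nat.cast_pow] at h
  rw [← h]
  refine tsum_congr fun m => ?_
  rw [p]
  ring

lemma prod_Q (N : ℕ) (h : ℕ) (hh : h ≤ N) :
    (∏ j ∈ Icc 1 h, (1 - q ^ (N + 1 - j))) * Q q (N - h) = Q q N := by
  induction h with
  | zero => simp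
  | succ h ih =>
    rw [prod_Icc_succ_top (by omega), ← ih (by omega)]
    have e : N - h = (N - (h + 1)) + 1 := by omega
    rw [e, Q_succ]
    have e2 : N + 1 - (h + 1) = N - (h + 1) + 1 := by omega
    rw [e2]
    ring

/-- Unnormalised partial moments. -/
noncomputable def S (q : ℝ) (n k : ℕ) : ℝ := ∑ m ∈ range n, (m : ℝ) ^ k * a q m

lemma momentE_eq (hq0 : 0 < q) (hq1 : q < 1) (N k : ℕ) :
    momentE q (N + 1) k =
      Q q N * ∑ m ∈ range (N + 1), (((N + 1 : ℕ) : ℝ) - m) ^ k * a q m := by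
  rw [momentE, mul_sum]
  refine sum_nbij' (fun h => N + 1 - h) (fun m => N + 1 - m) ?_ ?_ ?_ ?_ ?_
  · intro h hh; simp at hh ⊢; omega
  · intro h hh; simp at hh ⊢; omega
  · intro h hh; simp at hh ⊢; omega
  · intro h hh; simp at hh ⊢; omega
  · intro h hh
    simp only [mem_Icc] at hh
    rw [Nat.cast_sub hh.2, ← prod_Q N (h - 1) (by omega), a]
    have e : N - (h - 1) = N + 1 - h := by omega
    have := (Q_pos hq0 hq1 (N + 1 - h)).ne'
    rw [e, sub_sub_cancel]
    field_simp

lemma Q_mul_S_zero (hq0 : 0 < q) (hq1 : q < 1) (N : ℕ) : Q q N * S q (N + 1) 0 = 1 := by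
  induction N with
  | zero => simp [S, a, Q]
  | succ N ih =>
    have h : S q (N + 1 + 1) 0 = S q (N + 1) 0 + a q (N + 1) := by
      simp [S, sum_range_succ]
    have h2 := (Q_pos hq0 hq1 (N + 1)).ne'
    have h3 : Q q (N + 1) * a q (N + 1) = q ^ (N + 1) := by
      rw [a]; field_simp
    rw [h, mul_add, h3, Q_succ]
    linear_combination (1 - q ^ (N + 1)) * ih

/-- The fifth cumulant as a polynomial in moments. -/
def kap (e1 e2 e3 e4 e5 : ℝ) : ℝ :=
  e5 - 5 * e1 * e4 - 10 * e2 * e3 + 20 * e1 ^ 2 * e3 + 30 * e1 * e2 ^ 2 - 60 * e1 ^ 3 * e2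
    + 24 * e1 ^ 5

lemma kap_moment (hq0 : 0 < q) (hq1 : q < 1) (N : ℕ) :
    kap (momentE q (N + 1) 1) (momentE q (N + 1) 2) (momentE q (N + 1) 3) (momentE q (N + 1) 4)
      (momentE q (N + 1) 5) =
    - kap (S q (N + 1) 1 / S q (N + 1) 0) (S q (N + 1) 2 / S q (N + 1) 0)
      (S q (N + 1) 3 / S q (N + 1) 0) (S q (N + 1) 4 / S q (N + 1) 0)
      (S q (N + 1) 5 / S q (N + 1) 0) := by
  have h0 := Q_mul_S_zero hq0 hq1 N
  have hQ : ∀ x, x / S q (N + 1) 0 = Q q N * x := by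
    intro x
    have : S q (N + 1) 0 ≠ 0 := right_ne_zero_of_mul_eq_one h0
    field_simp
    linear_combination -x * h0
  simp only [hQ]
  have lin : ∀ (c : ℕ → ℝ) (k : ℕ), (∀ m : ℕ, (((N + 1 : ℕ) : ℝ) - m) ^ k =
      ∑ j ∈ range (k + 1), c j * (m : ℝ) ^ j) →
      momentE q (N + 1) k = ∑ j ∈ range (k + 1), c j * (Q q N * S q (N + 1) j) := by
    intro c k hc
    rw [momentE_eq hq0 hq1]
    simp only [hc, S, mul_sum, sum_mul]
    rw [sum_comm]
    refine sum_congr rfl fun j _ => sum_congr rfl fun m _ => ?_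
    ring
  have bin : ∀ k : ℕ, momentE q (N + 1) k = ∑ j ∈ range (k + 1),
      ((-1) ^ j * ((N + 1 : ℕ) : ℝ) ^ (k - j) * (k.choose j : ℝ)) * (Q q N * S q (N + 1) j) := by
    intro k
    refine lin _ k fun m => ?_
    rw [sub_eq_neg_add, add_pow]
    refine sum_congr rfl fun j _ => ?_
    rw [neg_pow]
    ring
  have b1 := bin 1
  have b2 := bin 2
  have b3 := bin 3
  have b4 := bin 4
  have b5 := bin 5
  simp only [sum_range_succ, sum_range_zero, h0] at b1 b2 b3 b4 b5
  norm_num [Nat.choose] at b1 b2 b3 b4 b5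
  rw [b1, b2, b3, b4, b5]
  unfold kap
  ring

lemma kap_limit (hq0 : 0 < q) (hq1 : q < 1) :
    kap (A q 1 / A q 0) (A q 2 / A q 0) (A q 3 / A q 0) (A q 4 / A q 0) (A q 5 / A q 0)
      = P q 4 := by
  have hA : 0 < A q 0 :=
    (summable_a hq0 hq1 0).tsum_pos
      (fun m => mul_nonneg (by positivity) (a_pos hq0 hq1 m).le) 0
      (by simpa using a_pos hq0 hq1 0)
  have b1 := recursion hq0 hq1 0
  have b2 := recursion hq0 hq1 1
  have b3 := recursion hq0 hq1 2
  have b4 := recursion hq0 hq1 3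
  have b5 := recursion hq0 hq1 4
  simp only [sum_range_succ, sum_range_zero] at b1 b2 b3 b4 b5
  norm_num [Nat.choose] at b1 b2 b3 b4 b5
  rw [b5, b4, b3, b2, b1]
  unfold kap
  field_simp
  ring

lemma tendsto_S (hq0 : 0 < q) (hq1 : q < 1) (k : ℕ) :
    Tendsto (fun n => S q n k) atTop (𝓝 (A q k)) :=
  (summable_a hq0 hq1 k).hasSum.tendsto_sum_nat

end FifthCumulant

open FifthCumulant in
theorem fifth_cumulant_limit (q : ℝ) (hq0 : 0 < q) (hq1 : q < 1) :
    Filter.Tendsto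
      (fun n : ℕ => momentE q n 5 - 5 * momentE q n 1 * momentE q n 4
        - 10 * momentE q n 2 * momentE q n 3 + 20 * (momentE q n 1) ^ 2 * momentE q n 3
        + 30 * momentE q n 1 * (momentE q n 2) ^ 2 - 60 * (momentE q n 1) ^ 3 * momentE q n 2
        + 24 * (momentE q n 1) ^ 5)
      Filter.atTop
      (nhds (-(∑' m : ℕ, (∑ d ∈ (m + 1).divisors, (d : ℝ) ^ 4) * q ^ (m + 1)))) := by
  rw [← P_four hq0 hq1, ← kap_limit hq0 hq1]
  have hA : 0 < A q 0 :=
    (summable_a hq0 hq1 0).tsum_pos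
      (fun m => mul_nonneg (by positivity) (a_pos hq0 hq1 m).le) 0
      (by simpa using a_pos hq0 hq1 0)
  have t : ∀ k, Tendsto (fun n => S q n k / S q n 0) atTop (𝓝 (A q k / A q 0)) := fun k =>
    (tendsto_S hq0 hq1 k).div (tendsto_S hq0 hq1 0) hA.ne'
  have main : Tendsto (fun n => - kap (S q n 1 / S q n 0) (S q n 2 / S q n 0)
      (S q n 3 / S q n 0) (S q n 4 / S q n 0) (S q n 5 / S q n 0)) atTop
      (𝓝 (- kap (A q 1 / A q 0) (A q 2 / A q 0) (A q 3 / A q 0) (A q 4 / A q 0)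
        (A q 5 / A q 0))) := by
    unfold kap
    exact ((((((((t 5).sub (((t 1).const_mul 5).mul (t 4))).sub
      (((t 2).const_mul 10).mul (t 3))).add ((((t 1).pow 2).const_mul 20).mul (t 3))).add
      (((t 1).const_mul 30).mul ((t 2).pow 2))).sub
      ((((t 1).pow 3).const_mul 60).mul (t 2))).add (((t 1).pow 5).const_mul 24))).neg
  refine main.congr' ?_
  filter_upwards [eventually_gt_atTop 0] with n hn
  obtain ⟨N, rfl⟩ : ∃ N, n = N + 1 := ⟨n - 1, by omega⟩
  rw [← kap_moment hq0 hq1 N]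
  rfl
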